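/- Let T be a tree of diameter 5 with vertex set {v_1, ..., v_n}, where v_1 and v_2 are its two central vertices (the two adjacent vertices of eccentricity 3). For k = 1, 2, let NL_k be the set of neighbours of v_k other than v_{3-k} that are not leaves of T. If |NL_1| = 1, then T^(2), the vertex-multiplication of T in which every vertex is assigned multiplicity 2, admits an orientation D of diameter 5 in which every vertex lies on a directed cycle of length at most 4. -/

import Mathlib

open SimpleGraph

variable {V : Type*}

/-- `D` is an orientation of `G`: every arc of `D` is an edge of `G`, and every edge of `G`
receives exactly one of the two possible directions. -/
def IsOrientation (G : SimpleGraph V) (D : V → V → Prop) : Prop :=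
  (∀ u v, D u v → G.Adj u v) ∧ ∀ u v, G.Adj u v → (D u v ↔ ¬ D v u)

/-- There is a directed walk of length `n` from `u` to `v` in the digraph `D`. -/
def DPath (D : V → V → Prop) : ℕ → V → V → Prop
  | 0, u, v => u = v
  | n + 1, u, v => ∃ w, D u w ∧ DPath D n w v

/-- Directed distance from `u` to `v` (`⊤` if `v` is not reachable from `u`). -/
noncomputable def ddist (D : V → V → Prop) (u v : V) : ℕ∞ :=
  sInf {n : ℕ∞ | ∃ m : ℕ, n = (m : ℕ∞) ∧ DPath D m u v}

/-- Diameter of a digraph: supremum of directed distances over all ordered pairs. -/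
noncomputable def odiam (D : V → V → Prop) : ℕ∞ :=
  ⨆ u : V, ⨆ v : V, ddist D u v

/-- A strong orientation of `G`: an orientation in which every vertex is reachable
from every other vertex by a directed path. -/
def IsStrongOrientation (G : SimpleGraph V) (D : V → V → Prop) : Prop :=
  IsOrientation G D ∧ ∀ u v, ∃ m : ℕ, DPath D m u v

/-- The orientation number of `G`: minimum diameter over all strong orientations. -/
noncomputable def orientNum (G : SimpleGraph V) : ℕ∞ :=
  sInf {d : ℕ∞ | ∃ D : V → V → Prop, IsStrongOrientation G D ∧ d = odiam D}

/-- The vertex-multiplication `G(s)`: vertex `v` is replaced by `s v` copies, and copies of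
`v_i`, `v_j` are adjacent iff `v_i v_j` is an edge of `G` (whence `i ≠ j`). -/
def vertexMult (G : SimpleGraph V) (s : V → ℕ) : SimpleGraph (Σ v : V, Fin (s v)) where
  Adj x y := G.Adj x.1 y.1
  symm := ⟨fun _ _ h => G.symm.symm _ _ h⟩
  loopless := ⟨fun x h => G.loopless.irrefl x.1 h⟩

/-- Eccentricity of a vertex. -/
noncomputable def ecc (G : SimpleGraph V) (v : V) : ℕ∞ :=
  ⨆ u : V, G.edist v u

/-- `v` is reachable from `u` by a directed walk of length at most `n`. -/
def ReachWithin (D : V → V → Prop) (n : ℕ) (u v : V) : Prop :=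
  ∃ m ≤ n, DPath D m u v

namespace ReachWithin

variable {D : V → V → Prop}

theorem refl (n : ℕ) (u : V) : ReachWithin D n u u := ⟨0, Nat.zero_le n, rfl⟩

theorem mono {m n : ℕ} {u v : V} (hmn : m ≤ n) (h : ReachWithin D m u v) :
    ReachWithin D n u v :=
  let ⟨k, hk, hp⟩ := h
  ⟨k, hk.trans hmn, hp⟩

theorem cons {n : ℕ} {u w v : V} (huw : D u w) (h : ReachWithin D n w v) :
    ReachWithin D (n + 1) u v :=
  let ⟨k, hk, hp⟩ := h
  ⟨k + 1, Nat.succ_le_succ hk, w, huw, hp⟩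

theorem single {u v : V} (huv : D u v) : ReachWithin D 1 u v :=
  cons huv (refl 0 v)

theorem ddist_le {n : ℕ} {u v : V} (h : ReachWithin D n u v) : ddist D u v ≤ n :=
  let ⟨k, hk, hp⟩ := h
  le_trans (sInf_le (by exact ⟨k, rfl, hp⟩)) (Nat.cast_le.mpr hk)

end ReachWithin

/-- A digraph on two copies `c u 0`, `c u 1` of every `u : V`, with two adjacent centres `v₁`,
`v₂`, their other neighbours `N₁`, `N₂`, a set `L₁` of vertices hanging from a single `a ∈ N₁`
and a set `L₂` of vertices hanging from members of `N₂`, all joined by the arcs listed. -/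
structure IsBroomPattern {α : Type*} (D : α → α → Prop) (c : V → Fin 2 → α) (v₁ v₂ a b : V)
    (N₁ N₂ L₁ L₂ : V → Prop) : Prop where
  mem_a : N₁ a
  mem_b : N₂ b
  centre : ∀ j, D (c v₁ 0) (c v₂ j) ∧ D (c v₂ j) (c v₁ 1)
  arc_N₁ : ∀ u, N₁ u → ∀ j, D (c v₁ 1) (c u j) ∧ D (c u j) (c v₁ 0)
  arc_N₂ : ∀ u, N₂ u → ∀ i, D (c v₂ i) (c u i) ∧ D (c u i) (c v₂ (i + 1))
  arc_L₁ : ∀ u, L₁ u → ∀ i, D (c a i) (c u i) ∧ D (c u i) (c a (i + 1))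
  arc_L₂ : ∀ u, L₂ u → ∃ w, N₂ w ∧ ∀ j, D (c w 0) (c u j) ∧ D (c u j) (c w 1)
  cover : ∀ u, u = v₁ ∨ u = v₂ ∨ N₁ u ∨ N₂ u ∨ L₁ u ∨ L₂ u

namespace IsBroomPattern

open ReachWithin

variable {α : Type*} {D : α → α → Prop} {c : V → Fin 2 → α} {v₁ v₂ a b : V}
  {N₁ N₂ L₁ L₂ : V → Prop}

theorem centre_two_reach (h : IsBroomPattern D c v₁ v₂ a b N₁ N₂ L₁ L₂) (i j : Fin 2) :
    ReachWithin D 2 (c v₂ i) (c v₂ j) := by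
  obtain rfl | rfl : j = i ∨ j = i + 1 := by revert i j; decide
  · exact refl _ _
  · exact cons (h.arc_N₂ b h.mem_b i).1 (single (h.arc_N₂ b h.mem_b i).2)

theorem L₂_reach (h : IsBroomPattern D c v₁ v₂ a b N₁ N₂ L₁ L₂) {y : V} (hy : L₂ y)
    (j : Fin 2) : ReachWithin D 2 (c v₂ 0) (c y j) := by
  obtain ⟨w, hw, hwy⟩ := h.arc_L₂ y hy
  exact cons (h.arc_N₂ w hw 0).1 (single (hwy j).1)

theorem N₁_centre_one (h : IsBroomPattern D c v₁ v₂ a b N₁ N₂ L₁ L₂) {u : V} (hu : N₁ u)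
    (j : Fin 2) : ReachWithin D 1 (c v₁ 1) (c u j) :=
  single (h.arc_N₁ u hu j).1

theorem L₁_reach (h : IsBroomPattern D c v₁ v₂ a b N₁ N₂ L₁ L₂) {x : V} (hx : L₁ x)
    (j : Fin 2) : ReachWithin D 2 (c v₁ 1) (c x j) :=
  cons (h.arc_N₁ a h.mem_a j).1 (single (h.arc_L₁ x hx j).1)

theorem centre_one_one_zero (h : IsBroomPattern D c v₁ v₂ a b N₁ N₂ L₁ L₂) :
    ReachWithin D 2 (c v₁ 1) (c v₁ 0) :=
  cons (h.arc_N₁ a h.mem_a 0).1 (single (h.arc_N₁ a h.mem_a 0).2)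

/-- The first copy of `v₁` reaches everything within four steps. -/
theorem reach_centre_one_zero (h : IsBroomPattern D c v₁ v₂ a b N₁ N₂ L₁ L₂) (u : V)
    (j : Fin 2) : ReachWithin D 4 (c v₁ 0) (c u j) := by
  have key {n : ℕ} {t : α} (ht : ReachWithin D n (c v₁ 1) t) :
      ReachWithin D (n + 2) (c v₁ 0) t :=
    cons (h.centre 0).1 (cons (h.centre 0).2 ht)
  rcases h.cover u with rfl | rfl | hu | hu | hu | hu
  · obtain rfl | rfl : j = 0 ∨ j = 1 := by revert j; decide
    · exact refl _ _
    · exact key (refl 2 _)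
  · exact (single (h.centre j).1).mono (by norm_num)
  · exact (key (h.N₁_centre_one hu j)).mono (by norm_num)
  · exact (cons (h.centre j).1 (single (h.arc_N₂ u hu j).1)).mono (by norm_num)
  · exact key (h.L₁_reach hu j)
  · exact (cons (h.centre 0).1 (h.L₂_reach hu j)).mono (by norm_num)

/-- Each copy of `v₂` reaches everything within four steps. -/
theorem reach_centre_two (h : IsBroomPattern D c v₁ v₂ a b N₁ N₂ L₁ L₂) (i : Fin 2) (u : V)
    (j : Fin 2) : ReachWithin D 4 (c v₂ i) (c u j) := by
  have key {n : ℕ} {t : α} (ht : ReachWithin D n (c v₁ 1) t) :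
      ReachWithin D (n + 1) (c v₂ i) t :=
    cons (h.centre i).2 ht
  have shift {n : ℕ} {t : α} {k : Fin 2} (ht : ReachWithin D n (c v₂ k) t) :
      ReachWithin D (n + 2) (c v₂ i) t := by
    obtain rfl | rfl : k = i ∨ k = i + 1 := by clear key ht; revert i k; decide
    · exact ht.mono (by omega)
    · exact cons (h.arc_N₂ b h.mem_b i).1 (cons (h.arc_N₂ b h.mem_b i).2 ht)
  rcases h.cover u with rfl | rfl | hu | hu | hu | hu
  · obtain rfl | rfl : j = 0 ∨ j = 1 := by revert j; decide
    · exact (key h.centre_one_one_zero).mono (by norm_num)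
    · exact key (refl 3 _)
  · exact (h.centre_two_reach i j).mono (by norm_num)
  · exact (key (h.N₁_centre_one hu j)).mono (by norm_num)
  · exact (shift (single (h.arc_N₂ u hu j).1)).mono (by norm_num)
  · exact (key (h.L₁_reach hu j)).mono (by norm_num)
  · exact shift (h.L₂_reach hu j)

/-- The first copy of `v₂` reaches everything within three steps. -/
theorem reach_centre_two_zero (h : IsBroomPattern D c v₁ v₂ a b N₁ N₂ L₁ L₂) (u : V)
    (j : Fin 2) : ReachWithin D 3 (c v₂ 0) (c u j) := by
  have key {n : ℕ} {t : α} (ht : ReachWithin D n (c v₁ 1) t) :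
      ReachWithin D (n + 1) (c v₂ 0) t :=
    cons (h.centre 0).2 ht
  rcases h.cover u with rfl | rfl | hu | hu | hu | hu
  · obtain rfl | rfl : j = 0 ∨ j = 1 := by revert j; decide
    · exact key h.centre_one_one_zero
    · exact key (refl 2 _)
  · exact (h.centre_two_reach 0 j).mono (by norm_num)
  · exact (key (h.N₁_centre_one hu j)).mono (by norm_num)
  · obtain rfl | rfl : j = 0 ∨ j = 1 := by revert j; decide
    · exact (single (h.arc_N₂ u hu 0).1).mono (by norm_num)
    · exact cons (h.arc_N₂ b h.mem_b 0).1 (cons (h.arc_N₂ b h.mem_b 0).2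
        (single (h.arc_N₂ u hu 1).1))
  · exact key (h.L₁_reach hu j)
  · exact (h.L₂_reach hu j).mono (by norm_num)

/-- The second copy of `v₁` reaches everything within five steps. -/
theorem reach_centre_one_one (h : IsBroomPattern D c v₁ v₂ a b N₁ N₂ L₁ L₂) (u : V)
    (j : Fin 2) : ReachWithin D 5 (c v₁ 1) (c u j) := by
  have key {n : ℕ} {t : α} (ht : ReachWithin D n (c v₁ 0) t) :
      ReachWithin D (n + 2) (c v₁ 1) t :=
    cons (h.arc_N₁ a h.mem_a 0).1 (cons (h.arc_N₁ a h.mem_a 0).2 ht)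
  rcases h.cover u with rfl | rfl | hu | hu | hu | hu
  · obtain rfl | rfl : j = 0 ∨ j = 1 := by revert j; decide
    · exact key (refl 3 _)
    · exact refl _ _
  · exact (key (single (h.centre j).1)).mono (by norm_num)
  · exact (h.N₁_centre_one hu j).mono (by norm_num)
  · exact (key (cons (h.centre j).1 (single (h.arc_N₂ u hu j).1))).mono (by norm_num)
  · exact (h.L₁_reach hu j).mono (by norm_num)
  · exact key (cons (h.centre 0).1 (h.L₂_reach hu j))

/-- Two vertices hanging from `a` are within four steps of each other. -/
theorem L₁_reach_L₁ (h : IsBroomPattern D c v₁ v₂ a b N₁ N₂ L₁ L₂) {x u : V} (hx : L₁ x)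
    (hu : L₁ u) (i j : Fin 2) : ReachWithin D 4 (c x i) (c u j) := by
  obtain rfl | rfl : j = i ∨ j = i + 1 := by revert i j; decide
  · have hj : j + 1 + 1 = j := by revert j; decide
    refine cons (h.arc_L₁ x hx j).2 (cons (h.arc_L₁ x hx (j + 1)).1
      (cons (h.arc_L₁ x hx (j + 1)).2 (single ?_)))
    rw [hj]
    exact (h.arc_L₁ u hu j).1
  · exact (cons (h.arc_L₁ x hx i).2 (single (h.arc_L₁ u hu (i + 1)).1)).mono (by norm_num)

theorem reach (h : IsBroomPattern D c v₁ v₂ a b N₁ N₂ L₁ L₂) (u w : V) (i j : Fin 2) :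
    ReachWithin D 5 (c u i) (c w j) := by
  rcases h.cover u with rfl | rfl | hu | hu | hu | hu
  · obtain rfl | rfl : i = 0 ∨ i = 1 := by revert i; decide
    · exact (h.reach_centre_one_zero w j).mono (by norm_num)
    · exact h.reach_centre_one_one w j
  · exact (h.reach_centre_two i w j).mono (by norm_num)
  · exact cons (h.arc_N₁ u hu i).2 (h.reach_centre_one_zero w j)
  · exact cons (h.arc_N₂ u hu i).2 (h.reach_centre_two _ w j)
  · have key {n : ℕ} {t : α} (ht : ReachWithin D n (c v₁ 0) t) :
        ReachWithin D (n + 2) (c u i) t :=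
      cons (h.arc_L₁ u hu i).2 (cons (h.arc_N₁ a h.mem_a _).2 ht)
    have key' {n : ℕ} {t : α} (ht : ReachWithin D n (c v₁ 1) t) :
        ReachWithin D (n + 4) (c u i) t :=
      key (cons (h.centre 0).1 (cons (h.centre 0).2 ht))
    rcases h.cover w with rfl | rfl | hw | hw | hw | hw
    · obtain rfl | rfl : j = 0 ∨ j = 1 := by revert j; decide
      · exact key (refl 3 _)
      · exact key' (refl 1 _)
    · exact (key (single (h.centre j).1)).mono (by norm_num)
    · exact key' (h.N₁_centre_one hw j)
    · exact (key (cons (h.centre j).1 (single (h.arc_N₂ w hw j).1))).mono (by norm_num)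
    · exact (h.L₁_reach_L₁ hu hw i j).mono (by norm_num)
    · exact key (cons (h.centre 0).1 (h.L₂_reach hw j))
  · obtain ⟨b', hb', hbu⟩ := h.arc_L₂ u hu
    exact cons (hbu i).2 (cons (h.arc_N₂ b' hb' 1).2 (h.reach_centre_two_zero w j))

/-- Every vertex lies on a closed directed walk of length four. -/
theorem closed_walk (h : IsBroomPattern D c v₁ v₂ a b N₁ N₂ L₁ L₂) (u : V) (i : Fin 2) :
    DPath D 4 (c u i) (c u i) := by
  have hi : i + 1 + 1 = i := by revert i; decide
  rcases h.cover u with rfl | rfl | hu | hu | hu | hu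
  · obtain rfl | rfl : i = 0 ∨ i = 1 := by revert i; decide
    · exact ⟨_, (h.centre 0).1, _, (h.centre 0).2, _, (h.arc_N₁ a h.mem_a 0).1, _,
        (h.arc_N₁ a h.mem_a 0).2, rfl⟩
    · exact ⟨_, (h.arc_N₁ a h.mem_a 0).1, _, (h.arc_N₁ a h.mem_a 0).2, _, (h.centre 0).1, _,
        (h.centre 0).2, rfl⟩
  · exact ⟨_, (h.centre i).2, _, (h.arc_N₁ a h.mem_a 0).1, _, (h.arc_N₁ a h.mem_a 0).2, _,
      (h.centre i).1, rfl⟩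
  · exact ⟨_, (h.arc_N₁ u hu i).2, _, (h.centre 0).1, _, (h.centre 0).2, _,
      (h.arc_N₁ u hu i).1, rfl⟩
  · refine ⟨_, (h.arc_N₂ u hu i).2, _, (h.arc_N₂ u hu _).1, _, (h.arc_N₂ u hu _).2, _,
      (h.arc_N₂ u hu _).1, ?_⟩
    rw [hi]; rfl
  · refine ⟨_, (h.arc_L₁ u hu i).2, _, (h.arc_L₁ u hu _).1, _, (h.arc_L₁ u hu _).2, _,
      (h.arc_L₁ u hu _).1, ?_⟩
    rw [hi]; rfl
  · obtain ⟨w, hw, hwu⟩ := h.arc_L₂ u hu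
    exact ⟨_, (hwu i).2, _, (h.arc_N₂ w hw 1).2, _, (h.arc_N₂ w hw 0).1, _, (hwu i).1, rfl⟩

end IsBroomPattern

/-- `p` is the parent of `u` in the tree `T` rooted at `r`. -/
def IsParent (T : SimpleGraph V) (r p u : V) : Prop :=
  T.Adj p u ∧ T.dist r u = T.dist r p + 1

/-- Orient an edge of `T^(2)` between a copy of a parent and a copy of its child downwards when
`F` holds for the two copies, and upwards otherwise. -/
def rootedOrientation (T : SimpleGraph V) (r : V)
    (F : (Σ _ : V, Fin 2) → (Σ _ : V, Fin 2) → Prop) (x y : Σ _ : V, Fin 2) : Prop :=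
  IsParent T r x.1 y.1 ∧ F x y ∨ IsParent T r y.1 x.1 ∧ ¬ F y x

theorem rootedOrientation_down {T : SimpleGraph V} {r : V}
    {F : (Σ _ : V, Fin 2) → (Σ _ : V, Fin 2) → Prop} {x y : Σ _ : V, Fin 2}
    (h : IsParent T r x.1 y.1) (hF : F x y) : rootedOrientation T r F x y :=
  .inl ⟨h, hF⟩

theorem rootedOrientation_up {T : SimpleGraph V} {r : V}
    {F : (Σ _ : V, Fin 2) → (Σ _ : V, Fin 2) → Prop} {x y : Σ _ : V, Fin 2}
    (h : IsParent T r y.1 x.1) (hF : ¬ F y x) : rootedOrientation T r F x y :=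
  .inr ⟨h, hF⟩

theorem isOrientation_rootedOrientation {T : SimpleGraph V} (hT : T.IsTree) (r : V)
    (F : (Σ _ : V, Fin 2) → (Σ _ : V, Fin 2) → Prop) :
    IsOrientation (vertexMult T (fun _ : V => 2)) (rootedOrientation T r F) := by
  refine ⟨fun x y h => ?_, fun x y h => ?_⟩
  · rcases h with h | h
    · exact h.1.1
    · exact h.1.1.symm
  · have hxy : T.Adj x.1 y.1 := h
    have hyx := hxy.symm
    have := hT.dist_eq_dist_add_one_of_adj r hxy
    unfold rootedOrientation IsParent
    by_cases h1 : F x y <;> by_cases h2 : F y x <;> simp only [hxy, hyx, h1, h2] <;> grind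

/-- A directed walk in an orientation of a vertex-multiplication projects to a walk. -/
theorem edist_le_of_dPath {T : SimpleGraph V} {s : V → ℕ}
    {D : (Σ v : V, Fin (s v)) → (Σ v : V, Fin (s v)) → Prop}
    (hD : IsOrientation (vertexMult T s) D) {m : ℕ} {x y : Σ v : V, Fin (s v)}
    (h : DPath D m x y) : T.edist x.1 y.1 ≤ m := by
  induction m generalizing x with
  | zero => cases h; simp
  | succ m ih =>
    obtain ⟨w, hw, hp⟩ := h
    have hadj : T.Adj x.1 w.1 := hD.1 _ _ hw
    calc T.edist x.1 y.1 ≤ T.edist x.1 w.1 + T.edist w.1 y.1 := T.edist_triangle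
      _ ≤ 1 + m := add_le_add (edist_eq_one_iff_adj.mpr hadj).le (ih hp)
      _ = ((m + 1 : ℕ) : ℕ∞) := by push_cast; ring

theorem ediam_le_odiam {T : SimpleGraph V} {s : V → ℕ} (hs : ∀ v, 0 < s v)
    {D : (Σ v : V, Fin (s v)) → (Σ v : V, Fin (s v)) → Prop}
    (hD : IsOrientation (vertexMult T s) D) : T.ediam ≤ odiam D := by
  refine ediam_le_of_edist_le fun u v => ?_
  refine le_trans ?_ (le_iSup₂ (f := ddist D) ⟨u, 0, hs u⟩ ⟨v, 0, hs v⟩)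
  refine le_sInf ?_
  rintro _ ⟨m, rfl, hp⟩
  exact edist_le_of_dPath hD hp

theorem dist_le_of_ecc_eq {T : SimpleGraph V} (hT : T.Connected) {v : V} {k : ℕ}
    (h : ecc T v = k) (u : V) : T.dist v u ≤ k := by
  have : T.edist v u ≤ ecc T v := le_iSup (T.edist v) u
  rw [h, ← (hT v u).coe_dist_eq_edist] at this
  exact_mod_cast this

theorem exists_dist_eq_of_ecc_eq {T : SimpleGraph V} (hT : T.Connected) {v : V} {k : ℕ}
    (h : ecc T v = (k + 1 : ℕ)) : ∃ u, T.dist v u = k + 1 := by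
  by_contra! hne
  have : ecc T v ≤ k := iSup_le fun u => by
    rw [← (hT v u).coe_dist_eq_edist]
    have := dist_le_of_ecc_eq hT h u
    have := hne u
    exact_mod_cast (by omega : T.dist v u ≤ k)
  rw [h] at this
  exact absurd (Nat.cast_le.mp this) (by omega)

theorem exists_adj_adj_of_dist_eq_two {T : SimpleGraph V} {u v : V} (h : T.dist u v = 2) :
    ∃ w, T.Adj u w ∧ T.Adj w v := by
  obtain ⟨p, hp⟩ := exists_walk_of_dist_ne_zero (by omega : T.dist u v ≠ 0)
  rw [h] at hp
  match p, hp with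
  | .cons h₁ (.cons h₂ .nil), _ => exact ⟨_, h₁, h₂⟩

open Classical in
/-- The rule used to orient arcs from copies of a parent to copies of a child. -/
def downRule (T : SimpleGraph V) (v₁ v₂ : V) (x y : Σ _ : V, Fin 2) : Prop :=
  if x.1 = v₁ then (if y.1 = v₂ then x.2 = 0 else x.2 = 1)
  else if x.1 = v₂ ∨ T.Adj v₁ x.1 then x.2 = y.2 else x.2 = 0

theorem stmt15 [Fintype V] (T : SimpleGraph V) (hT : T.IsTree) (hdiam : T.ediam = 5)
    (v₁ v₂ : V) (hadj : T.Adj v₁ v₂) (hecc₁ : ecc T v₁ = 3) (hecc₂ : ecc T v₂ = 3)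
    (hNL₁ : {u : V | T.Adj v₁ u ∧ u ≠ v₂ ∧ (T.neighborSet u).ncard ≠ 1}.ncard = 1) :
    ∃ D : (Σ _ : V, Fin 2) → (Σ _ : V, Fin 2) → Prop,
      IsOrientation (vertexMult T (fun _ : V => 2)) D ∧ odiam D = 5 ∧
      ∀ x : Σ _ : V, Fin 2, ∃ k : ℕ, 1 ≤ k ∧ k ≤ 4 ∧ DPath D k x x := by
  have hc := hT.connected
  have d₁ := dist_le_of_ecc_eq hc (k := 3) hecc₁
  have d₂ := dist_le_of_ecc_eq hc (k := 3) hecc₂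
  have hd12 : T.dist v₁ v₂ = 1 := dist_eq_one_iff_adj.mpr hadj
  have hself : T.dist v₁ v₁ = 0 := dist_self
  obtain ⟨a, ha⟩ := Set.ncard_eq_one.mp hNL₁
  have haN : T.Adj v₁ a ∧ a ≠ v₂ := by
    have : a ∈ ({a} : Set V) := rfl
    rw [← ha] at this
    exact ⟨this.1, this.2.1⟩
  have parent_unique {w u : V} (hw : T.Adj v₁ w) (hw2 : w ≠ v₂) (hwu : IsParent T v₁ w u) :
      w = a := by
    have hu : u ≠ v₁ := by
      rintro rfl
      have := hwu.2
      omega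
    have : w ∈ ({a} : Set V) := by
      rw [← ha]
      refine ⟨hw, hw2, fun h1 => hu ?_⟩
      obtain ⟨z, hz⟩ := Set.ncard_eq_one.mp h1
      have e₁ : u ∈ T.neighborSet w := hwu.1
      have e₂ : v₁ ∈ T.neighborSet w := hw.symm
      rw [hz] at e₁ e₂
      exact e₁.trans e₂.symm
    exact this
  have far {u : V} (hu : T.dist v₁ u = 3) : ∃ w, IsParent T v₁ v₂ w ∧ IsParent T v₁ w u := by
    have h2 : T.dist v₂ u = 2 := by
      have e := hT.dist_eq_dist_add_one_of_adj u hadj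
      rw [dist_comm (u := u), dist_comm (u := u)] at e
      have := d₂ u
      omega
    obtain ⟨w, hw, hwu⟩ := exists_adj_adj_of_dist_eq_two h2
    have e₁ := hT.dist_eq_dist_add_one_of_adj v₁ hw
    have e₂ := hT.dist_eq_dist_add_one_of_adj v₁ hwu
    exact ⟨w, ⟨hw, by omega⟩, ⟨hwu, by omega⟩⟩
  obtain ⟨b, hb⟩ : ∃ b, IsParent T v₁ v₂ b := by
    obtain ⟨u, hu⟩ := exists_dist_eq_of_ecc_eq hc (k := 2) hecc₁
    obtain ⟨w, hw, -⟩ := far hu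
    exact ⟨w, hw⟩
  have par₁ {u : V} (hu : T.Adj v₁ u) : IsParent T v₁ v₁ u :=
    ⟨hu, by rw [hself, dist_eq_one_iff_adj.mpr hu]⟩
  have h21 : v₂ ≠ v₁ := hadj.ne'
  set F := downRule T v₁ v₂ with hF
  have hD := isOrientation_rootedOrientation hT v₁ F
  set D := rootedOrientation T v₁ F
  have pat : IsBroomPattern D (fun v i => ⟨v, i⟩) v₁ v₂ a b
      (fun u => T.Adj v₁ u ∧ u ≠ v₂) (IsParent T v₁ v₂) (IsParent T v₁ a)
      (fun u => ∃ w, IsParent T v₁ v₂ w ∧ IsParent T v₁ w u) := by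
    refine ⟨haN, hb, fun j => ⟨?_, ?_⟩, fun u hu j => ⟨?_, ?_⟩, fun u hu i => ⟨?_, ?_⟩,
      fun u hu i => ⟨?_, ?_⟩, ?_, fun u => ?_⟩
    · exact rootedOrientation_down (par₁ hadj) (by simp [hF, downRule])
    · exact rootedOrientation_up (par₁ hadj) (by simp [hF, downRule])
    · exact rootedOrientation_down (par₁ hu.1) (by simp [hF, downRule, hu.2])
    · exact rootedOrientation_up (par₁ hu.1) (by simp [hF, downRule, hu.2])
    · exact rootedOrientation_down hu (by simp [hF, downRule, h21])
    · exact rootedOrientation_up hu (by simp [hF, downRule, h21])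
    · exact rootedOrientation_down hu (by simp [hF, downRule, haN.1.ne', haN.1])
    · exact rootedOrientation_up hu (by simp [hF, downRule, haN.1.ne', haN.1])
    · rintro u ⟨w, hw, hwu⟩
      have hw2 : T.dist v₁ w = 2 := by rw [hw.2, hd12]
      have n₁ : w ≠ v₁ := by rintro rfl; omega
      have n₂ : w ≠ v₂ := hw.1.ne'
      have n₃ : ¬ T.Adj v₁ w := fun h => by
        have := dist_eq_one_iff_adj.mpr h
        omega
      refine ⟨w, hw, fun j => ⟨?_, ?_⟩⟩
      · exact rootedOrientation_down hwu (by simp [hF, downRule, n₁, n₂, n₃])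
      · exact rootedOrientation_up hwu (by simp [hF, downRule, n₁, n₂, n₃])
    · have hu3 := d₁ u
      obtain h | h | h | h : T.dist v₁ u = 0 ∨ T.dist v₁ u = 1 ∨ T.dist v₁ u = 2 ∨
          T.dist v₁ u = 3 := by omega
      · exact .inl (hc.dist_eq_zero_iff.mp h).symm
      · by_cases hu : u = v₂
        · exact .inr (.inl hu)
        · exact .inr (.inr (.inl ⟨dist_eq_one_iff_adj.mp h, hu⟩))
      · obtain ⟨w, hw, hwu⟩ := exists_adj_adj_of_dist_eq_two h
        have hp : IsParent T v₁ w u := ⟨hwu, by rw [h, dist_eq_one_iff_adj.mpr hw]⟩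
        by_cases hw2 : w = v₂
        · exact .inr (.inr (.inr (.inl (hw2 ▸ hp))))
        · exact .inr (.inr (.inr (.inr (.inl (parent_unique hw hw2 hp ▸ hp)))))
      · exact .inr (.inr (.inr (.inr (.inr (far h)))))
  refine ⟨D, hD, le_antisymm ?_ ?_, fun x => ⟨4, by norm_num, le_rfl, pat.closed_walk x.1 x.2⟩⟩
  · exact iSup₂_le fun x y => (pat.reach x.1 y.1 x.2 y.2).ddist_le
  · rw [← hdiam]
    exact ediam_le_odiam (fun _ => by norm_num) hD
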